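/- Let S be a finite set, let F be a family of subsets of S, and let t be a positive integer. Suppose that F contains a t-partition and a (1 mod t)-partition. Then for all sufficiently large positive integers n, the cartesian power S^n can be partitioned into elements of F(n), where F(n) is the family of all subsets of S^n of the form {s_1} × ... × {s_{i−1}} × F × {s_{i+1}} × ... × {s_n} with i ∈ [n], s_1,...,s_{i−1},s_{i+1},...,s_n ∈ S and F ∈ F. -/

import Mathlib

namespace PowPart
open Set

universe u v

/-- `P` is a disjoint union of members of `T`. -/
def Tile {X : Type*} (T : Set (Set X)) (P : Set X) : Prop :=
  ∃ C : Set (Set X), C ⊆ T ∧ C.PairwiseDisjoint id ∧ ⋃₀ C = P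

theorem Tile.fibers {X : Type*} {κ : Type*} {T : Set (Set X)} {P : Set X} (φ : X → κ)
    (h : ∀ k, Tile T {x | x ∈ P ∧ φ x = k}) : Tile T P := by
  choose C hC hd hu using h
  refine ⟨⋃ k, C k, ?_, ?_, ?_⟩
  · exact iUnion_subset hC
  · intro A hA B hB hne
    simp only [mem_iUnion] at hA hB
    obtain ⟨k, hA⟩ := hA
    obtain ⟨l, hB⟩ := hB
    by_cases hkl : k = l
    · subst hkl
      exact hd k hA hB hne
    · have h1 : A ⊆ {x | x ∈ P ∧ φ x = k} := by rw [← hu k]; exact subset_sUnion_of_mem hA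
      have h2 : B ⊆ {x | x ∈ P ∧ φ x = l} := by rw [← hu l]; exact subset_sUnion_of_mem hB
      refine Set.disjoint_left.2 fun x hx hx' => hkl ?_
      rw [← (h1 hx).2, ← (h2 hx').2]
  · ext x
    simp only [sUnion_iUnion, hu, mem_iUnion, mem_ofPred_eq]
    constructor
    · rintro ⟨k, hk, _⟩; exact hk
    · intro hx; exact ⟨_, hx, rfl⟩

theorem Tile.empty {X : Type*} (T : Set (Set X)) : Tile T ∅ :=
  ⟨∅, by simp, by simp, by simp⟩

theorem Tile.of_mem {X : Type*} {T : Set (Set X)} {A : Set X} (h : A ∈ T) : Tile T A :=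
  ⟨{A}, by simpa using h, by simp, by simp⟩

theorem Tile.congr {X : Type*} {T : Set (Set X)} {A B : Set X} (h : Tile T A) (e : B = A) :
    Tile T B := e ▸ h

/-- If the fibre is either empty or tileable. -/
theorem Tile.sep {X : Type*} {T : Set (Set X)} {A : Set X} (p : Prop) (h : p → Tile T A) :
    Tile T {x | p ∧ x ∈ A} := by
  by_cases hp : p
  · exact (h hp).congr (by ext; simp [hp])
  · exact (Tile.empty T).congr (by ext; simp [hp])

/-- Image of a tiling under a map whose preimage function sends tiles to tiles. -/
theorem Tile.image {X Y : Type*} {T : Set (Set X)} {T' : Set (Set Y)} (f : X → Y)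
    (hf : Function.Injective f) (h : ∀ A ∈ T, f '' A ∈ T') {P : Set X} (hP : Tile T P) :
    Tile T' (f '' P) := by
  obtain ⟨C, hC, hd, hu⟩ := hP
  refine ⟨(fun A => f '' A) '' C, ?_, ?_, ?_⟩
  · rintro _ ⟨A, hA, rfl⟩; exact h A (hC hA)
  · rintro _ ⟨A, hA, rfl⟩ _ ⟨B, hB, rfl⟩ hne
    have : A ≠ B := fun h => hne (by rw [h])
    exact (Set.disjoint_image_iff hf).2 (hd hA hB this)
  · rw [← hu, sUnion_image, sUnion_eq_biUnion, image_iUnion₂]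

def prodT {X Y : Type*} (T : Set (Set X)) (T' : Set (Set Y)) : Set (Set (X × Y)) :=
  {A | (∃ B ∈ T, ∃ y, A = {z | z.1 ∈ B ∧ z.2 = y}) ∨ (∃ B ∈ T', ∃ x, A = {z | z.1 = x ∧ z.2 ∈ B})}

def piT {X : Type*} (K : Type*) (T : Set (Set X)) : Set (Set (K → X)) :=
  {A | ∃ B ∈ T, ∃ k, ∃ s : K → X, A = {f | f k ∈ B ∧ ∀ j, j ≠ k → f j = s j}}

theorem Tile.prod_left {X Y : Type*} {T : Set (Set X)} {T' : Set (Set Y)} {P : Set (X × Y)}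
    (h : ∀ y, Tile T {x | (x, y) ∈ P}) : Tile (prodT T T') P := by
  refine Tile.fibers (fun z => z.2) fun y => ?_
  refine ((h y).image (T' := prodT T T') (fun x => (x, y)) (fun a b h => by simpa using h) ?_).congr ?_
  · intro A hA
    exact Or.inl ⟨A, hA, y, by ext ⟨a, b⟩; simp; grind⟩
  · ext ⟨a, b⟩; simp; grind

theorem Tile.prod_right {X Y : Type*} {T : Set (Set X)} {T' : Set (Set Y)} {P : Set (X × Y)}
    (h : ∀ x, Tile T' {y | (x, y) ∈ P}) : Tile (prodT T T') P := by
  refine Tile.fibers (fun z => z.1) fun y => ?_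
  refine ((h y).image (T' := prodT T T') (fun x => (y, x)) (fun a b h => by simpa using h) ?_).congr ?_
  · intro A hA
    exact Or.inr ⟨A, hA, y, by ext ⟨a, b⟩; simp; grind⟩
  · ext ⟨a, b⟩; simp; grind

open Classical in
theorem Tile.pi_fiber {X K : Type*} {T : Set (Set X)} {P : Set (K → X)} (k : K)
    (h : ∀ f : K → X, Tile T {x | Function.update f k x ∈ P}) : Tile (piT K T) P := by
  refine Tile.fibers (fun f (j : {j // j ≠ k}) => f j) fun s => ?_
  by_cases hne : ∃ f0 : K → X, (fun (j : {j // j ≠ k}) => f0 j) = s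
  · obtain ⟨f0, rfl⟩ := hne
    refine ((h f0).image (T' := piT K T) (fun x => Function.update f0 k x)
      (fun a b h => by simpa using congrFun h k) ?_).congr ?_
    · intro A hA
      refine ⟨A, hA, k, f0, ?_⟩
      ext f
      simp only [mem_image, mem_ofPred_eq]
      constructor
      · rintro ⟨x, hx, rfl⟩
        exact ⟨by simpa using hx, fun j hj => by simp [hj]⟩
      · rintro ⟨h1, h2⟩
        refine ⟨f k, h1, ?_⟩
        ext j
        by_cases hj : j = k
        · subst hj; simp
        · simp [hj, h2 j hj]
    · ext f
      simp only [mem_image, mem_ofPred_eq]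
      constructor
      · rintro ⟨h1, h2⟩
        have : Function.update f0 k (f k) = f := by
          ext j
          by_cases hj : j = k
          · subst hj; simp
          · simpa [hj] using (congrFun h2 ⟨j, hj⟩).symm
        exact ⟨f k, by rwa [this], this⟩
      · rintro ⟨x, hx, rfl⟩
        exact ⟨hx, by ext ⟨j, hj⟩; simp [hj]⟩
  · refine (Tile.empty _).congr ?_
    ext f
    simp only [mem_ofPred_eq, mem_empty_iff_false, iff_false]
    rintro ⟨_, h2⟩
    exact hne ⟨f, h2⟩

/-- `{f | ∃ j, f j ∈ A j}` is tileable. -/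
theorem Tile.exists_coord {X K : Type*} [Finite K] {T : Set (Set X)} (A : K → Set X)
    (hA : ∀ k, Tile T (A k)) : Tile (piT K T) {f | ∃ j, f j ∈ A j} := by
  classical
  obtain ⟨n, ⟨e⟩⟩ := Finite.exists_equiv_fin K
  have key : ∀ m : ℕ, Tile (piT K T) {f | ∃ j, (e j : ℕ) < m ∧ f j ∈ A j} := by
    intro m
    induction m with
    | zero => exact (Tile.empty _).congr (by ext; simp)
    | succ m ih =>
      refine Tile.fibers (fun f => (∃ j, (e j : ℕ) < m ∧ f j ∈ A j)) fun p => ?_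
      by_cases hp : p
      · refine ih.congr ?_
        ext f
        simp only [mem_ofPred_eq, hp, eq_iff_iff, iff_true]
        constructor
        · exact fun h => h.2
        · exact fun h => ⟨by obtain ⟨j, h1, h2⟩ := h; exact ⟨j, by omega, h2⟩, h⟩
      · by_cases hm : ∃ k, (e k : ℕ) = m
        · obtain ⟨k, hk⟩ := hm
          refine Tile.pi_fiber k fun f => ?_
          refine (Tile.sep (¬ ∃ j, (e j : ℕ) < m ∧ f j ∈ A j) (fun _ => hA k)).congr ?_
          ext x
          have h1 : (∃ j, (e j : ℕ) < m ∧ Function.update f k x j ∈ A j) ↔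
              ∃ j, (e j : ℕ) < m ∧ f j ∈ A j := by
            refine exists_congr fun j => ?_
            by_cases hj : j = k
            · subst hj; simp [hk]
            · simp [hj]
          simp only [mem_ofPred_eq, hp, eq_iff_iff, iff_false]
          rw [h1]
          constructor
          · rintro ⟨⟨j, h2, h3⟩, h4⟩
            refine ⟨h4, ?_⟩
            by_cases hj : j = k
            · subst hj; simpa using h3
            · refine absurd ⟨j, ?_, by simpa [hj] using h3⟩ h4
              have : (e j : ℕ) ≠ m := fun h => hj (e.injective (Fin.ext (h.trans hk.symm)))
              omega
          · rintro ⟨h4, h5⟩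
            exact ⟨⟨k, by omega, by simpa using h5⟩, h4⟩
        · refine (Tile.empty _).congr ?_
          ext f
          simp only [mem_ofPred_eq, hp, eq_iff_iff, iff_false, mem_empty_iff_false]
          rintro ⟨⟨j, h2, h3⟩, h4⟩
          refine h4 ⟨j, ?_, h3⟩
          have : (e j : ℕ) ≠ m := fun h => hm ⟨j, h⟩
          omega
  refine (key n).congr ?_
  ext f; simp

theorem Tile.prodl {X Y : Type*} {T : Set (Set X)} {T' : Set (Set Y)} {A : Set X}
    (h : Tile T A) (D : Set Y) : Tile (prodT T T') (A ×ˢ D) := by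
  refine Tile.prod_left fun y => ?_
  exact (Tile.sep (y ∈ D) (fun _ => h)).congr (by ext; simp [and_comm])

theorem Tile.prodr {X Y : Type*} {T : Set (Set X)} {T' : Set (Set Y)} {A : Set Y}
    (D : Set X) (h : Tile T' A) : Tile (prodT T T') (D ×ˢ A) := by
  refine Tile.prod_right fun y => ?_
  exact (Tile.sep (y ∈ D) (fun _ => h)).congr (by ext; simp)

/-- Deleting some coordinate keeps a small set of points distinct. -/
theorem exists_coord_injOn {X : Type*} {M : ℕ} (W : Finset (Fin M → X))
    (h : W.card * W.card < M) :
    ∃ i : Fin M, ∀ w ∈ W, ∀ w' ∈ W, (∀ j, j ≠ i → w j = w' j) → w = w' := by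
  classical
  by_contra! hcon
  choose a ha b hb hab hne using hcon
  have : Fintype.card (Fin M) ≤ (W ×ˢ W).card := by
    rw [← Finset.card_univ]
    refine Finset.card_le_card_of_injOn (fun i => (a i, b i)) ?_ ?_
    · intro i _; simp [ha, hb]
    · intro i _ j _ hij
      by_contra hne'
      simp only [Prod.mk.injEq] at hij
      apply hne i
      ext l
      by_cases hl : l = i
      · rw [hij.1, hij.2]
        exact hab j l (by rw [hl]; exact hne')
      · exact hab i l hl
  simp at this
  omega

theorem two_cover {X : Type u} [Fintype X] {T : Set (Set X)} (F : X → Set X)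
    (hF : ∀ x, Tile T (F x)) (hx : ∀ x, x ∈ F x) (M : ℕ)
    (hM : Fintype.card X * Fintype.card X < M) :
    ∃ P P' : Set ((Fin M → X) × (((Fin M → X) → X) → X)),
      Tile (prodT (piT (Fin M) T) (piT ((Fin M → X) → X) T)) P ∧
      Tile (prodT (piT (Fin M) T) (piT ((Fin M → X) → X) T)) P' ∧
      ∀ z, z ∈ P ∨ z ∈ P' := by
  classical
  let W : (((Fin M → X) → X) → X) → Finset (Fin M → X) := fun e =>
    Finset.univ.filter fun w => ∀ j : (Fin M → X) → X, e j ∉ F (j w)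
  have hW : ∀ e, (W e).card < Fintype.card X := by
    intro e
    by_contra! hc
    rw [← Finset.card_univ] at hc
    have : ∃ j : (Fin M → X) → X, ∀ x, ∃ w ∈ W e, j w = x := by
      obtain ⟨g, hg⟩ := (Function.Embedding.nonempty_of_card_le (α := X) (β := W e)
        (by simpa using hc))
      by_cases hX : Nonempty X
      · refine ⟨Function.invFun (fun x => (g x : Fin M → X)), fun x => ⟨g x, (g x).2, ?_⟩⟩
        exact Function.leftInverse_invFun (f := fun x => (g x : Fin M → X)) (fun a b h => hg (Subtype.ext h)) x
      · rw [not_nonempty_iff] at hX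
        have : 0 < M := by omega
        exact ⟨fun w => w ⟨0, this⟩, fun x => isEmptyElim x⟩
    obtain ⟨j, hj⟩ := this
    obtain ⟨w, hw, hjw⟩ := hj (e j)
    have := (Finset.mem_filter.1 hw).2 j
    rw [hjw] at this
    exact this (hx _)
  have hi : ∀ e, ∃ i : Fin M, ∀ w ∈ W e, ∀ w' ∈ W e, (∀ j, j ≠ i → w j = w' j) → w = w' := by
    intro e
    apply exists_coord_injOn
    have := hW e
    nlinarith
  choose i hi using hi
  refine ⟨{z | ∃ j, z.2 j ∈ F (j z.1)},
    {z | ∃ w ∈ W z.2, z.1 (i z.2) ∈ F (w (i z.2)) ∧ ∀ j, j ≠ i z.2 → z.1 j = w j}, ?_, ?_, ?_⟩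
  · refine Tile.prod_right fun w => ?_
    exact Tile.exists_coord (fun j : (Fin M → X) → X => F (j w)) (fun j => hF _)
  · refine Tile.prod_left fun e => ?_
    refine Tile.pi_fiber (i e) fun f => ?_
    by_cases hw : ∃ w ∈ W e, ∀ j, j ≠ i e → f j = w j
    · obtain ⟨w, hw, hfw⟩ := hw
      refine (hF (w (i e))).congr ?_
      ext x
      simp only [mem_ofPred_eq, Function.update_self]
      constructor
      · rintro ⟨w', hw', h1, h2⟩
        have : w = w' := by
          refine hi e w hw w' hw' fun j hj => ?_
          rw [← hfw j hj, ← h2 j hj]; simp [hj]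
        rw [this]; exact h1
      · intro h
        exact ⟨w, hw, h, fun j hj => by simp [hj, hfw j hj]⟩
    · refine (Tile.empty _).congr ?_
      ext x
      simp only [mem_ofPred_eq, mem_empty_iff_false, iff_false]
      rintro ⟨w', hw', h1, h2⟩
      exact hw ⟨w', hw', fun j hj => by rw [← h2 j hj]; simp [hj]⟩
  · rintro ⟨w, e⟩
    by_cases h : w ∈ W e
    · right
      exact ⟨w, h, hx _, fun _ _ => rfl⟩
    · left
      simpa [W] using h


inductive Lab (ι : Type*)
  | o : Lab ι
  | b : ι → Lab ι
  | e : ι → Lab ι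
  | junk : Lab ι

set_option linter.unusedSimpArgs false in
theorem star {X : Type*} {ι : Type*} [Finite ι] {T : Set (Set X)} {P P' : Set X}
    (hP : Tile T P) (hP' : Tile T P') (hc : ∀ x, x ∈ P ∨ x ∈ P') :
    ∃ l : (ι → X) → Lab ι,
      (∀ i, Tile (piT ι T) {f | l f = Lab.o ∨ l f = Lab.b i}) ∧
      (∀ i, Tile (piT ι T) {f | l f = Lab.b i ∨ l f = Lab.e i}) ∧
      (∀ i, Tile (piT ι T) {f | l f ≠ Lab.e i}) ∧
      Tile (piT ι T) {f | l f ≠ Lab.o} := by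
  classical
  let isO : (ι → X) → Prop := fun f => ∀ j, f j ∉ P
  let isB : ι → (ι → X) → Prop := fun i f => f i ∈ P ∧ f i ∈ P' ∧ ∀ j, j ≠ i → f j ∉ P
  let isE : ι → (ι → X) → Prop := fun i f => f i ∉ P' ∧ ∀ j, j ≠ i → f j ∉ P
  let l : (ι → X) → Lab ι := fun f =>
    if isO f then Lab.o else if h : ∃ i, isB i f then Lab.b h.choose else
      if h : ∃ i, isE i f then Lab.e h.choose else Lab.junk
  have hBO : ∀ i f, isB i f → ¬ isO f := fun i f h h' => h' i h.1
  have hEO : ∀ i f, isE i f → ¬ isO f := fun i f h h' => (hc (f i)).elim (h' i) h.1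
  have hBB : ∀ i j f, isB i f → isB j f → i = j := by
    intro i j f h h'
    by_contra hne
    exact h'.2.2 i hne h.1
  have hEP : ∀ i f, isE i f → f i ∈ P := fun i f h => (hc (f i)).resolve_right h.1
  have hBE : ∀ i j f, isB i f → ¬ isE j f := by
    intro i j f h h'
    by_cases hne : i = j
    · subst hne; exact h'.1 h.2.1
    · exact h'.2 i hne h.1
  have hEE : ∀ i j f, isE i f → isE j f → i = j := by
    intro i j f h h'
    by_contra hne
    exact h'.2 i hne (hEP i f h)
  have lo : ∀ f, l f = Lab.o ↔ isO f := by
    intro f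
    simp only [l]
    split_ifs <;> simp_all
  have lb : ∀ i f, l f = Lab.b i ↔ isB i f := by
    intro i f
    simp only [l]
    split_ifs with h1 h2 h3
    · simp only [false_iff, reduceCtorEq]; exact fun h => hBO i f h h1
    · rw [Lab.b.injEq]
      exact ⟨fun h => h ▸ h2.choose_spec, fun h => hBB _ _ f h2.choose_spec h⟩
    · simp only [false_iff, reduceCtorEq]; exact fun h => h2 ⟨i, h⟩
    · simp only [false_iff, reduceCtorEq]; exact fun h => h2 ⟨i, h⟩
  have le : ∀ i f, l f = Lab.e i ↔ isE i f := by
    intro i f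
    simp only [l]
    split_ifs with h1 h2 h3
    · simp only [false_iff, reduceCtorEq]; exact fun h => hEO i f h h1
    · simp only [false_iff, reduceCtorEq]; exact fun h => hBE _ _ f h2.choose_spec h
    · rw [Lab.e.injEq]
      exact ⟨fun h => h ▸ h3.choose_spec, fun h => hEE _ _ f h3.choose_spec h⟩
    · simp only [false_iff, reduceCtorEq]; exact fun h => h3 ⟨i, h⟩
  have upd : ∀ (i : ι) (f : ι → X) (x : X),
      (∀ j, j ≠ i → Function.update f i x j ∉ P) ↔ ∀ j, j ≠ i → f j ∉ P := by
    intro i f x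
    refine forall_congr' fun j => forall_congr' fun hj => ?_
    simp [hj]
  refine ⟨l, fun i => ?_, fun i => ?_, fun i => ?_, ?_⟩
  · refine Tile.pi_fiber i fun f => ?_
    refine (Tile.sep (∀ j, j ≠ i → f j ∉ P) (fun _ => hP')).congr ?_
    ext x
    simp only [mem_ofPred_eq, lo, lb]
    have : isO (Function.update f i x) ↔ x ∉ P ∧ ∀ j, j ≠ i → f j ∉ P := by
      rw [← upd i f x]
      constructor
      · intro h; exact ⟨by simpa using h i, fun j _ => h j⟩
      · rintro ⟨h1, h2⟩ j
        by_cases hj : j = i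
        · subst hj; simpa using h1
        · exact h2 j hj
    rw [this]
    simp only [isB, upd, Function.update_self]
    have := hc x
    tauto
  · refine Tile.pi_fiber i fun f => ?_
    refine (Tile.sep (∀ j, j ≠ i → f j ∉ P) (fun _ => hP)).congr ?_
    ext x
    simp only [mem_ofPred_eq, le, lb]
    simp only [isB, isE, upd, Function.update_self]
    have := hc x
    tauto
  · refine (Tile.exists_coord (T := T) (fun j => if j = i then P' else P)
      (fun j => by by_cases h : j = i <;> simp [h, hP, hP'])).congr ?_
    ext f
    simp only [mem_ofPred_eq, ne_eq, le, isE]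
    constructor
    · intro h
      by_contra! h2
      refine h ⟨by simpa using h2 i, fun j hj => by simpa [hj] using h2 j⟩
    · rintro ⟨j, hj⟩ ⟨h1, h2⟩
      by_cases h : j = i
      · subst h; simp at hj; exact h1 hj
      · simp [h] at hj; exact h2 j h hj
  · refine (Tile.exists_coord (T := T) (fun _ : ι => P) (fun _ => hP)).congr ?_
    ext f
    simp [lo, isO]

/-- The region `R`, with rows in `A` and columns in `A'` removed. -/
def Reg {U U' ι κ : Type*} (l : U → Lab ι) (r : U' → Lab κ) (A : Set ι) (A' : Set κ) :
    Set (U × U') :=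
  {z | (∃ i, i ∉ A ∧ l z.1 = Lab.e i ∧ r z.2 = Lab.o) ∨
       (∃ i k, l z.1 = Lab.e i ∧ r z.2 = Lab.b k) ∨
       (∃ i k, l z.1 = Lab.b i ∧ r z.2 = Lab.b k) ∨
       (∃ k, k ∉ A' ∧ l z.1 = Lab.o ∧ r z.2 = Lab.b k)}

theorem reg_tile {U U' ι κ : Type*} {T : Set (Set U)} {T' : Set (Set U')}
    (l : U → Lab ι) (r : U' → Lab κ)
    (h1 : ∀ i, Tile T {f | l f = Lab.o ∨ l f = Lab.b i})
    (h2 : ∀ i, Tile T {f | l f = Lab.b i ∨ l f = Lab.e i})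
    (h3 : ∀ k, Tile T' {f | r f = Lab.o ∨ r f = Lab.b k})
    (A : Set ι) (A' : Set κ) (s : {i // i ∉ A} ≃ {k // k ∉ A'}) :
    Tile (prodT T T') (Reg l r A A') := by
  classical
  let M : ι → κ → Prop := fun i k => ∃ (h : i ∉ A) (h' : k ∉ A'), s ⟨i, h⟩ = ⟨k, h'⟩
  have M1 : ∀ i, i ∉ A → ∃ k, M i k := fun i h => ⟨s ⟨i, h⟩, h, (s ⟨i, h⟩).2, rfl⟩
  have M2 : ∀ k, k ∉ A' → ∃ i, M i k := fun k h =>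
    ⟨s.symm ⟨k, h⟩, (s.symm ⟨k, h⟩).2, h, by simp⟩
  have M3 : ∀ i k k', M i k → M i k' → k = k' := by
    rintro i k k' ⟨a, b, c⟩ ⟨a', b', c'⟩
    rw [c] at c'; simpa using c'
  have M4 : ∀ i i' k, M i k → M i' k → i = i' := by
    rintro i i' k ⟨a, b, c⟩ ⟨a', b', c'⟩
    rw [← c'] at c; simpa using c
  have M5 : ∀ i k, M i k → i ∉ A ∧ k ∉ A' := fun i k h => ⟨h.1, h.2.1⟩
  clear_value M
  have M1' : ∀ i, ∃ o : Option κ, i ∉ A → ∃ k, o = some k ∧ M i k := by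
    intro i
    by_cases h : i ∈ A
    · exact ⟨none, fun h' => absurd h h'⟩
    · obtain ⟨k, hk⟩ := M1 i h
      exact ⟨some k, fun _ => ⟨k, rfl, hk⟩⟩
  have M2' : ∀ k, ∃ o : Option ι, k ∉ A' → ∃ i, o = some i ∧ M i k := by
    intro i
    by_cases h : i ∈ A'
    · exact ⟨none, fun h' => absurd h h'⟩
    · obtain ⟨k, hk⟩ := M2 i h
      exact ⟨some k, fun _ => ⟨k, rfl, hk⟩⟩
  choose p hp using M1'
  choose q hq using M2'
  let ψ : Lab ι → Lab κ → Option (ι × κ × Bool) := fun a b => match a, b with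
    | Lab.e i, Lab.o => (p i).map fun k => (i, k, true)
    | Lab.e i, Lab.b k => some (i, k, true)
    | Lab.b i, Lab.b k => if M i k then some (i, k, false) else some (i, k, true)
    | Lab.o, Lab.b k => (q k).map fun i => (i, k, false)
    | _, _ => none
  refine Tile.fibers (fun z => ψ (l z.1) (r z.2)) ?_
  rintro (_ | ⟨i, k, _ | _⟩)
  · refine (Tile.empty _).congr ?_
    ext ⟨u, u'⟩
    simp only [Reg, mem_ofPred_eq, mem_empty_iff_false, iff_false]
    rintro ⟨h | h | h | h, h'⟩
    · obtain ⟨i, hi, e1, e2⟩ := h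
      obtain ⟨k, hk, _⟩ := hp i hi
      simp [e1, e2, ψ, hk] at h'
    · obtain ⟨i, k, e1, e2⟩ := h
      simp [e1, e2, ψ] at h'
    · obtain ⟨i, k, e1, e2⟩ := h
      simp only [e1, e2, ψ] at h'
      split_ifs at h'
    · obtain ⟨k, hk, e1, e2⟩ := h
      obtain ⟨i, hi, _⟩ := hq k hk
      simp [e1, e2, ψ, hi] at h'
  · by_cases hM : M i k
    · refine (Tile.prodl (h1 i) {u' | r u' = Lab.b k}).congr ?_
      ext ⟨u, u'⟩
      simp only [Reg, mem_ofPred_eq, mem_prod, ψ]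
      cases hl : l u <;> cases hr : r u' <;> grind
    · refine (Tile.empty _).congr ?_
      ext ⟨u, u'⟩
      simp only [Reg, mem_ofPred_eq, mem_empty_iff_false, iff_false, ψ]
      cases hl : l u <;> cases hr : r u' <;> grind
  · by_cases hM : M i k
    · refine (Tile.prodr {u | l u = Lab.e i} (h3 k)).congr ?_
      ext ⟨u, u'⟩
      simp only [Reg, mem_ofPred_eq, mem_prod, ψ]
      cases hl : l u <;> cases hr : r u' <;> grind
    · refine (Tile.prodl (h2 i) {u' | r u' = Lab.b k}).congr ?_
      ext ⟨u, u'⟩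
      simp only [Reg, mem_ofPred_eq, mem_prod, ψ]
      cases hl : l u <;> cases hr : r u' <;> grind

theorem compl_tile {Y X : Type*} {T : Set (Set Y)} {T' : Set (Set X)} {P P' : Set X}
    (hP : Tile T' P) (hP' : Tile T' P') (hc : ∀ x, x ∈ P ∨ x ∈ P')
    (R Y0 : Set Y) (hY : Y0 ⊆ R) (h1 : Tile T (R \ Y0)) (h2 : Tile T Y0ᶜ) :
    Tile (prodT T T') {z | ¬ (z.1 ∈ R ∧ z.2 ∉ P)} := by
  classical
  refine Tile.fibers (fun z => z.1 ∈ Y0) fun p => ?_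
  by_cases hp : p
  · refine (Tile.prodr Y0 hP).congr ?_
    ext ⟨y, x⟩
    simp only [mem_ofPred_eq, mem_prod, hp, eq_iff_iff, iff_true]
    have := @hY y
    tauto
  refine Tile.fibers (fun z => z.2 ∈ P') fun q => ?_
  by_cases hq : q
  swap
  · refine (Tile.prodl h2 P'ᶜ).congr ?_
    ext ⟨y, x⟩
    simp only [mem_ofPred_eq, mem_prod, hp, hq, eq_iff_iff, iff_false, mem_compl_iff]
    have := hc x
    tauto
  refine Tile.fibers (fun z => z.1 ∈ R) fun s => ?_
  by_cases hs : s
  · refine (Tile.prodl h1 (P ∩ P')).congr ?_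
    ext ⟨y, x⟩
    simp only [mem_ofPred_eq, mem_prod, hp, hq, hs, eq_iff_iff, iff_false, iff_true, mem_sdiff,
      mem_inter_iff]
    tauto
  · refine (Tile.prodr Rᶜ hP').congr ?_
    ext ⟨y, x⟩
    simp only [mem_ofPred_eq, mem_prod, hp, hq, hs, eq_iff_iff, iff_false, iff_true, mem_compl_iff]
    have := @hY y
    tauto

theorem partB {X : Type*} {κ : Type*} [Finite κ] {T : Set (Set X)} {P P' : Set X}
    (hP : Tile T P) (hP' : Tile T P') (hc : ∀ x, x ∈ P ∨ x ∈ P')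
    (G : Option κ → Set X) (hG : ∀ i, Tile T (G i))
    (F : X → κ → Set X) (hF : ∀ x k, Tile T (F x k))
    (hcard : ∀ x y, Nat.card {i // x ∈ G i} = Nat.card {k // y ∈ F x k} + 1) :
    Tile (prodT T (prodT T (prodT (prodT (piT (Option κ) T) (piT κ T)) T))) Set.univ := by
  classical
  obtain ⟨l, l1, l2, l3, l4⟩ := star (ι := Option κ) hP hP' hc
  obtain ⟨r, r1, r2, r3, r4⟩ := star (ι := κ) hP hP' hc
  have hReg : ∀ (A : Set (Option κ)) (A' : Set κ), Nat.card A = Nat.card A' + 1 →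
      Tile (prodT (piT (Option κ) T) (piT κ T)) (Reg l r A A') := by
    intro A A' h
    have := Fintype.ofFinite κ
    have e : Nat.card {i // i ∉ A} = Nat.card {k // k ∉ A'} := by
      have e1 := Nat.card_congr (Equiv.sumCompl (fun i => i ∈ A))
      have e2 := Nat.card_congr (Equiv.sumCompl (fun i => i ∈ A'))
      rw [Nat.card_sum] at e1 e2
      simp only [Nat.card_eq_fintype_card, Fintype.card_option] at e1 e2 h ⊢
      simp only [← Nat.card_eq_fintype_card] at e1 e2 h ⊢
      change Nat.card A + _ = _ at e1
      change Nat.card A' + _ = _ at e2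
      omega
    exact reg_tile l r l1 l2 r1 A A' (Finite.card_eq.1 e).some
  let R := Reg l r ∅ ∅
  let Y0 : Set ((Option κ → X) × (κ → X)) := {z | l z.1 = Lab.e none ∧ r z.2 = Lab.o}
  have hY : Y0 ⊆ R := by
    rintro z ⟨a, b⟩
    exact Or.inl ⟨none, by simp, a, b⟩
  have hRY : Tile (prodT (piT (Option κ) T) (piT κ T)) (R \ Y0) := by
    refine (hReg {none} ∅ (by simp)).congr ?_
    ext ⟨u, u'⟩
    simp only [R, Y0, Reg, mem_ofPred_eq, mem_sdiff]
    cases hl : l u <;> cases hr : r u' <;> simp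
  have hYc : Tile (prodT (piT (Option κ) T) (piT κ T)) Y0ᶜ := by
    refine Tile.fibers (fun z => l z.1 = Lab.e none) fun p => ?_
    by_cases hp : p
    · refine (Tile.prodr {u | l u = Lab.e none} r4).congr ?_
      ext ⟨u, u'⟩
      simp [Y0, hp]; tauto
    · refine (Tile.prodl (l3 none) univ).congr ?_
      ext ⟨u, u'⟩
      simp [Y0, hp]; tauto
  have hC := compl_tile (T' := T) hP hP' hc R Y0 hY hRY hYc
  -- split according to whether the last coordinate lies in `R × E`
  refine Tile.fibers (fun z => z.2.2.1 ∈ R ∧ z.2.2.2 ∉ P) fun p => ?_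
  by_cases hp : p
  · have hp : p = True := by simp [hp]
    subst hp
    -- classify: row-removed, column-removed, rest
    refine Tile.fibers (fun z => ∃ i, l z.2.2.1.1 = Lab.e i ∧ r z.2.2.1.2 = Lab.o ∧ z.1 ∈ G i)
      fun p => ?_
    by_cases hp : p
    · have hp : p = True := by simp [hp]
      subst hp
      refine Tile.prod_left fun y => ?_
      by_cases hi : ∃ i, l y.2.1.1 = Lab.e i
      · obtain ⟨i, hi⟩ := hi
        refine (Tile.sep (r y.2.1.2 = Lab.o ∧ y.2.1 ∈ R ∧ y.2.2 ∉ P) (fun _ => hG i)).congr ?_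
        ext x
        simp [hi]; tauto
      · refine (Tile.empty _).congr ?_
        ext x
        simp only [not_exists] at hi
        simp [hi]
    · have hp : p = False := by simp [hp]
      subst hp
      refine Tile.prod_right fun x => ?_
      refine Tile.fibers (fun z => ∃ k, l z.2.1.1 = Lab.o ∧ r z.2.1.2 = Lab.b k ∧ z.1 ∈ F x k)
        fun p => ?_
      by_cases hp : p
      · have hp : p = True := by simp [hp]
        subst hp
        refine Tile.prod_left fun y => ?_
        by_cases hi : ∃ i, r y.1.2 = Lab.b i
        · obtain ⟨i, hi⟩ := hi
          refine (Tile.sep (l y.1.1 = Lab.o ∧ y.1 ∈ R ∧ y.2 ∉ P) (fun _ => hF x i)).congr ?_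
          ext x
          simp [hi]; tauto
        · refine (Tile.empty _).congr ?_
          ext x
          simp only [not_exists] at hi
          simp [hi]
      · have hp : p = False := by simp [hp]
        subst hp
        refine Tile.prod_right fun y => ?_
        refine (Tile.prodl (hReg {i | x ∈ G i} {k | y ∈ F x k} (hcard x y)) Pᶜ).congr ?_
        ext ⟨⟨u, u'⟩, e⟩
        simp only [R, Reg, mem_ofPred_eq, mem_prod]
        cases hl : l u <;> cases hr : r u' <;> simp <;> tauto
  · have hp : p = False := by simp [hp]
    subst hp
    refine Tile.prod_right fun x => ?_
    refine Tile.prod_right fun y => ?_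
    refine hC.congr ?_
    ext z
    simp

/-- The combinatorial lines of `S ^ I` in the directions of `𝓕`. -/
def lines {S : Type*} (𝓕 : Set (Finset S)) (I : Type*) : Set (Set (I → S)) :=
  {A | ∃ (i : I) (s : I → S) (F : Finset S), F ∈ 𝓕 ∧
    A = {g : I → S | g i ∈ F ∧ ∀ j, j ≠ i → g j = s j}}

/-- `X` with tiles `T` is a copy of `S ^ I` with (some of) its lines. -/
def Rep {S : Type*} (𝓕 : Set (Finset S)) (I : Type*) {X : Type*} (T : Set (Set X)) : Prop :=
  ∃ e : (I → S) ≃ X, ∀ A ∈ T, e ⁻¹' A ∈ lines 𝓕 I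

theorem Rep.base {S : Type*} [Nonempty S] (𝓕 : Set (Finset S)) :
    Rep 𝓕 Unit {A : Set S | ∃ F ∈ 𝓕, A = ↑F} := by
  refine ⟨Equiv.funUnique Unit S, ?_⟩
  rintro _ ⟨F, hF, rfl⟩
  refine ⟨(), fun _ => Classical.arbitrary S, F, hF, ?_⟩
  ext g
  simp

theorem Rep.self {S : Type*} (𝓕 : Set (Finset S)) (J : Type*) : Rep 𝓕 J (lines 𝓕 J) :=
  ⟨Equiv.refl _, fun _ hA => hA⟩

theorem Rep.prod {S : Type*} {𝓕 : Set (Finset S)} {I J X Y : Type*} {T : Set (Set X)}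
    {T' : Set (Set Y)} (h : Rep 𝓕 I T) (h' : Rep 𝓕 J T') : Rep 𝓕 (I ⊕ J) (prodT T T') := by
  obtain ⟨e, he⟩ := h
  obtain ⟨f, hf⟩ := h'
  refine ⟨(Equiv.sumArrowEquivProdArrow I J S).trans (e.prodCongr f), ?_⟩
  rintro _ (⟨B, hB, y, rfl⟩ | ⟨B, hB, y, rfl⟩)
  · obtain ⟨i, s, F, hF, hE⟩ := he B hB
    refine ⟨Sum.inl i, Sum.elim s (f.symm y), F, hF, ?_⟩
    ext g
    have := Set.ext_iff.1 hE (g ∘ Sum.inl)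
    simp only [mem_preimage, mem_ofPred_eq, Function.comp] at this
    have h2 : f (g ∘ Sum.inr) = y ↔ ∀ j, g (Sum.inr j) = f.symm y j := by
      rw [← Equiv.eq_symm_apply, funext_iff]; rfl
    simp [Equiv.sumArrowEquivProdArrow, Equiv.prodCongr]
    change e (g ∘ Sum.inl) ∈ B ∧ f (g ∘ Sum.inr) = y ↔ _
    rw [h2, this]
    tauto
  · obtain ⟨i, s, F, hF, hE⟩ := hf B hB
    refine ⟨Sum.inr i, Sum.elim (e.symm y) s, F, hF, ?_⟩
    ext g
    have := Set.ext_iff.1 hE (g ∘ Sum.inr)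
    simp only [mem_preimage, mem_ofPred_eq, Function.comp] at this
    have h2 : e (g ∘ Sum.inl) = y ↔ ∀ j, g (Sum.inl j) = e.symm y j := by
      rw [← Equiv.eq_symm_apply, funext_iff]; rfl
    simp [Equiv.sumArrowEquivProdArrow, Equiv.prodCongr]
    change e (g ∘ Sum.inl) = y ∧ f (g ∘ Sum.inr) ∈ B ↔ _
    rw [h2, this]
    tauto

theorem Rep.pi {S : Type*} {𝓕 : Set (Finset S)} {I X : Type*} {T : Set (Set X)} (K : Type*)
    (h : Rep 𝓕 I T) : Rep 𝓕 (K × I) (piT K T) := by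
  obtain ⟨e, he⟩ := h
  refine ⟨(Equiv.curry K I S).trans (Equiv.piCongrRight fun _ => e), ?_⟩
  rintro _ ⟨B, hB, k, s, rfl⟩
  obtain ⟨i, u, F, hF, hE⟩ := he B hB
  classical
  refine ⟨(k, i), fun p => if p.1 = k then u p.2 else e.symm (s p.1) p.2, F, hF, ?_⟩
  ext g
  have h1 := Set.ext_iff.1 hE (fun i => g (k, i))
  simp only [mem_preimage, mem_ofPred_eq] at h1
  have h2 : ∀ j, e (fun i => g (j, i)) = s j ↔ ∀ i, g (j, i) = e.symm (s j) i := by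
    intro j
    rw [← Equiv.eq_symm_apply, funext_iff]
  change (e (fun i => g (k, i)) ∈ B ∧ ∀ j, j ≠ k → e (fun i => g (j, i)) = s j) ↔ _
  simp only [h1, h2, mem_ofPred_eq, Prod.forall, ne_eq, Prod.mk.injEq]
  constructor
  · rintro ⟨⟨h3, h4⟩, h5⟩
    refine ⟨h3, fun a b hab => ?_⟩
    by_cases ha : a = k
    · subst ha
      simpa using h4 b (by tauto)
    · simpa [ha] using h5 a ha b
  · rintro ⟨h3, h4⟩
    refine ⟨⟨h3, fun j hj => ?_⟩, fun j hj i => ?_⟩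
    · simpa using h4 k j (by tauto)
    · simpa [hj] using h4 j i (by tauto)

theorem Rep.reindex {S : Type*} {𝓕 : Set (Finset S)} {I J X : Type*} {T : Set (Set X)}
    (h : Rep 𝓕 I T) (σ : I ≃ J) : Rep 𝓕 J T := by
  obtain ⟨e, he⟩ := h
  refine ⟨(σ.symm.arrowCongr (Equiv.refl S)).trans e, ?_⟩
  intro A hA
  obtain ⟨i, s, F, hF, hE⟩ := he A hA
  refine ⟨σ i, s ∘ σ.symm, F, hF, ?_⟩
  ext g
  have h1 := Set.ext_iff.1 hE (g ∘ σ)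
  simp only [mem_preimage, mem_ofPred_eq] at h1
  change e (g ∘ σ) ∈ A ↔ _
  rw [h1]
  simp only [Function.comp, mem_ofPred_eq]
  constructor
  · rintro ⟨h3, h4⟩
    refine ⟨h3, fun j hj => ?_⟩
    simpa using h4 (σ.symm j) (fun hh => hj (by simp [← hh]))
  · rintro ⟨h3, h4⟩
    refine ⟨h3, fun j hj => ?_⟩
    simpa using h4 (σ j) (by simpa using hj)

theorem Rep.tile {S : Type*} {𝓕 : Set (Finset S)} {I X : Type*} {T : Set (Set X)}
    (h : Rep 𝓕 I T) (hT : Tile T Set.univ) : Tile (lines 𝓕 I) Set.univ := by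
  obtain ⟨e, he⟩ := h
  refine (hT.image e.symm e.symm.injective (fun A hA => ?_)).congr (by simp)
  rw [e.symm.image_eq_preimage_symm]
  exact he A hA

theorem ncard_sigma {S : Type*} [Fintype S] [DecidableEq S] (w : Finset S → ℕ) (x : S) :
    {p : Σ F : Finset S, Fin (w F) | x ∈ p.1}.ncard =
      ∑ F ∈ Finset.univ.filter (fun F => x ∈ F), w F := by
  have : {p : Σ F : Finset S, Fin (w F) | x ∈ p.1} =
      ↑((Finset.univ.filter (fun F : Finset S => x ∈ F)).sigma
        (fun F => (Finset.univ : Finset (Fin (w F))))) := by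
    ext p; simp
  rw [this, Set.ncard_coe_finset, Finset.card_sigma]
  simp

theorem ncard_lt (N a : ℕ) (h : a ≤ N) : {n : Fin N | (n : ℕ) < a}.ncard = a := by
  have : (Fin.val '' {n : Fin N | (n : ℕ) < a}) = ↑(Finset.range a) := by
    ext n
    simp only [mem_image, mem_ofPred_eq, Finset.coe_range, mem_Iio]
    constructor
    · rintro ⟨m, hm, rfl⟩; exact hm
    · intro hn; exact ⟨⟨n, by omega⟩, hn, rfl⟩
  rw [← Set.ncard_image_of_injective _ Fin.val_injective, this, Set.ncard_coe_finset,
    Finset.card_range]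

theorem main_tile {S : Type u} [Fintype S] [DecidableEq S] [Nonempty S] (𝓕 : Set (Finset S))
    (t : ℕ) (ht : 0 < t) (w₁ : Finset S → ℕ) (hw₁ : ∀ F, w₁ F ≠ 0 → F ∈ 𝓕)
    (h₁ : ∀ x : S, ∑ F ∈ Finset.univ.filter (fun F => x ∈ F), w₁ F = t)
    (w₂ : Finset S → ℕ) (hw₂ : ∀ F, w₂ F ≠ 0 → F ∈ 𝓕) (a : S → ℕ)
    (h₂ : ∀ x : S, ∑ F ∈ Finset.univ.filter (fun F => x ∈ F), w₂ F = a x * t + 1) :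
    ∃ (I : Type u) (_ : Finite I), Tile (lines 𝓕 I) Set.univ := by
  have hex : ∀ x : S, ∃ F ∈ 𝓕, x ∈ F := by
    intro x
    have h : ∑ F ∈ Finset.univ.filter (fun F => x ∈ F), w₁ F ≠ 0 := by rw [h₁]; omega
    obtain ⟨F, hF, hne⟩ := Finset.exists_ne_zero_of_sum_ne_zero h
    exact ⟨F, hw₁ F hne, by simpa using hF⟩
  choose E hE hxE using hex
  let T₀ : Set (Set S) := {A | ∃ F ∈ 𝓕, A = ↑F}
  have hT₀ : ∀ F ∈ 𝓕, Tile T₀ (↑F : Set S) := fun F hF => Tile.of_mem ⟨F, hF, rfl⟩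
  obtain ⟨M', hM'⟩ : ∃ M', M' = Fintype.card S * Fintype.card S := ⟨_, rfl⟩
  let M := M' + 1
  obtain ⟨P, P', hP, hP', hc⟩ := two_cover (T := T₀) (fun x => (↑(E x) : Set S))
    (fun x => hT₀ _ (hE x)) (fun x => by simpa using hxE x)
    M (by omega)
  have hR₀ : Rep 𝓕 Unit T₀ := Rep.base 𝓕
  have hR₁ := (hR₀.pi (Fin M)).prod (hR₀.pi ((Fin M → S) → S))
  set T₁ := prodT (piT (Fin M) T₀) (piT ((Fin M → S) → S) T₀) with hT₁
  let c : (Fin M → S) × (((Fin M → S) → S) → S) → S := fun z => z.1 0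
  have hlift : ∀ F ∈ 𝓕, Tile T₁ {z | c z ∈ F} := by
    intro F hF
    have h : Tile (piT (Fin M) T₀) {f | f 0 ∈ F} := by
      refine Tile.pi_fiber 0 fun f => (hT₀ F hF).congr ?_
      ext x
      simp
    refine (Tile.prodl h Set.univ).congr ?_
    ext z
    simp [c]
  let α := Σ F : Finset S, Fin (w₂ F)
  let β := Σ F : Finset S, Fin (w₁ F)
  let N := ∑ x, a x
  have hN : ∀ x, a x ≤ N := fun x => Finset.single_le_sum (fun _ _ => Nat.zero_le _)
    (Finset.mem_univ x)
  let κ := α ⊕ (Fin N × β)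
  have hB := partB (κ := κ) hP hP' hc
    (fun i => {z | ∃ p : α, i = some (Sum.inl p) ∧ c z ∈ p.1})
    (by
      rintro (_ | (p | q))
      · exact (Tile.empty _).congr (by ext; simp)
      · refine (hlift p.1 (hw₂ _ ?_)).congr
          (Set.ext fun z => ⟨fun ⟨p', h, hz⟩ => by cases h; exact hz, fun hz => ⟨p, rfl, hz⟩⟩)
        have := p.2.2; omega
      · exact (Tile.empty _).congr (by ext; simp))
    (fun x k => {z | ∃ q : Fin N × β, k = Sum.inr q ∧ (q.1 : ℕ) < a (c x) ∧ c z ∈ q.2.1})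
    (by
      rintro x (p | q)
      · exact (Tile.empty _).congr (by ext; simp)
      · refine (Tile.sep ((q.1 : ℕ) < a (c x)) fun _ => hlift q.2.1 (hw₁ _ ?_)).congr
          (Set.ext fun z => ⟨fun ⟨q', h, hz⟩ => by cases h; exact hz, fun hz => ⟨q, rfl, hz⟩⟩)
        have := q.2.2.2; omega)
    (by
      intro x y
      have e1 : {i : Option κ | ∃ p : α, i = some (Sum.inl p) ∧ c x ∈ p.1} =
          (fun p : α => (some (Sum.inl p) : Option κ)) '' {p | c x ∈ p.1} := by
        ext i; simp only [mem_image, mem_ofPred_eq]; grind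
      have e2 : {k : κ | ∃ q : Fin N × β, k = Sum.inr q ∧ (q.1 : ℕ) < a (c x) ∧ c y ∈ q.2.1} =
          (fun q => (Sum.inr q : κ)) '' ({n : Fin N | (n : ℕ) < a (c x)} ×ˢ {p : β | c y ∈ p.1}) := by
        ext i; simp only [mem_image, mem_ofPred_eq, mem_prod]; grind
      have f1 : {i : Option κ | ∃ p : α, i = some (Sum.inl p) ∧ c x ∈ p.1}.ncard = a (c x) * t + 1 := by
        rw [e1, Set.ncard_image_of_injective _ (fun p q h => Sum.inl_injective (Option.some_injective _ h)), ncard_sigma, h₂]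
      have f2 : {k : κ | ∃ q : Fin N × β, k = Sum.inr q ∧ (q.1 : ℕ) < a (c x) ∧
          c y ∈ q.2.1}.ncard = a (c x) * t := by
        rw [e2, Set.ncard_image_of_injective _ (fun p q h => Sum.inr_injective h), Set.ncard_prod,
          ncard_sigma, ncard_lt _ _ (hN _), h₁]
      exact f1.trans (congrArg (· + 1) f2.symm))
  have hR := hR₁.prod (hR₁.prod (((hR₁.pi (Option κ)).prod (hR₁.pi κ)).prod hR₁))
  exact ⟨_, inferInstance, hR.tile hB⟩

theorem final {S : Type u} [Nonempty S] (𝓕 : Set (Finset S)) {I : Type*} [Finite I]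
    (h : Tile (lines 𝓕 I) Set.univ) (n : ℕ) (hn : Nat.card I ≤ n) :
    Tile (lines 𝓕 (Fin n)) Set.univ := by
  obtain ⟨m, rfl⟩ := Nat.exists_eq_add_of_le hn
  have hR := (Rep.self 𝓕 I).prod (Rep.self 𝓕 (Fin m))
  have e : I ⊕ Fin m ≃ Fin (Nat.card I + m) :=
    ((Finite.equivFin I).sumCongr (Equiv.refl _)).trans finSumFinEquiv
  refine (hR.reindex e).tile ((Tile.prodl h Set.univ).congr (by simp))

end PowPart

/-- **Gruslys–Leader–Tan.** Let `S` be a finite set, `𝓕` a family of subsets of `S` and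
`t` a positive integer. Suppose that `𝓕` contains a `t`-partition (a weight function on
subsets, supported on members of `𝓕`, giving every element of `S` weight exactly `t`) and
a `(1 mod t)`-partition (one giving every element weight congruent to `1` mod `t`). Then
for all sufficiently large `n`, the cartesian power `S^n` (modelled as `Fin n → S`) can be
partitioned into elements of `𝓕(n)`, i.e. into pairwise disjoint sets of the form
`{g : Fin n → S | g i ∈ F ∧ ∀ j ≠ i, g j = s j}` with `i : Fin n`, `s : Fin n → S` and
`F ∈ 𝓕`, whose union is all of `S^n`. -/
theorem power_partition_from_weighted_partitions
    (S : Type*) [Fintype S] [DecidableEq S] (𝓕 : Set (Finset S)) (t : ℕ) (ht : 0 < t)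
    (htpart : ∃ w : Finset S → ℕ, (∀ F, w F ≠ 0 → F ∈ 𝓕) ∧
      ∀ x : S, ∑ F ∈ Finset.univ.filter (fun F => x ∈ F), w F = t)
    (hmodtpart : ∃ w : Finset S → ℕ, (∀ F, w F ≠ 0 → F ∈ 𝓕) ∧
      ∀ x : S, (∑ F ∈ Finset.univ.filter (fun F => x ∈ F), w F) ≡ 1 [MOD t]) :
    ∃ n₀ : ℕ, ∀ n : ℕ, n₀ ≤ n →
      ∃ 𝒞 : Set (Set (Fin n → S)),
        (∀ A ∈ 𝒞, ∃ (i : Fin n) (s : Fin n → S) (F : Finset S), F ∈ 𝓕 ∧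
          A = {g : Fin n → S | g i ∈ F ∧ ∀ j, j ≠ i → g j = s j}) ∧
        𝒞.PairwiseDisjoint id ∧ ⋃₀ 𝒞 = Set.univ := by
  obtain ⟨w₁, hw₁, h₁⟩ := htpart
  obtain ⟨w₂, hw₂, h₂⟩ := hmodtpart
  cases isEmpty_or_nonempty S with
  | inl hS =>
    refine ⟨1, fun n hn => ⟨∅, by simp, by simp, ?_⟩⟩
    ext g
    exact (hS.false (g ⟨0, by omega⟩)).elim
  | inr hS =>
    have key : ∀ x : S, ∃ a : ℕ,
        ∑ F ∈ Finset.univ.filter (fun F => x ∈ F), (w₂ F + w₁ F) = a * t + 1 := by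
      intro x
      rw [Finset.sum_add_distrib, h₁ x]
      have h3 : 1 ≡ ∑ F ∈ Finset.univ.filter (fun F => x ∈ F), w₂ F + t [MOD t] := by
        have := (h₂ x).symm
        simpa [Nat.ModEq] using this
      obtain ⟨a, ha⟩ := (Nat.modEq_iff_dvd' (by omega)).1 h3
      refine ⟨a, ?_⟩
      rw [mul_comm a t, ← ha]
      omega
    choose a ha using key
    obtain ⟨I, hI, h⟩ := PowPart.main_tile 𝓕 t ht w₁ hw₁ h₁ (fun F => w₂ F + w₁ F)
      (fun F hF => by
        by_cases h : w₂ F = 0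
        · exact hw₁ F (by simp only [h] at hF; omega)
        · exact hw₂ F h) a ha
    refine ⟨Nat.card I, fun n hn => ?_⟩
    obtain ⟨C, hC, hd, hu⟩ := PowPart.final 𝓕 h n hn
    exact ⟨C, fun A hA => hC hA, hd, hu⟩
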